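/- arXiv:2002.10285 — 3 statements merged into one kernel-verified Lean document; each statement's English description precedes it below -/
import Mathlib

section
/- For every n ≥ 1 the face action ▷_f is a group action of G₋ on Gⁿ: 1 ▷_f d = d and x ▷_f (y ▷_f d) = (x·y) ▷_f d for all x, y ∈ G₋ and d ∈ Gⁿ. (The Lemma following Definition 3.5 of the paper, in the case of a face all of whose adjacent edges are oriented clockwise.) -/
/-- The partial face holonomy `hₖ(d) = π₊(d_{k-1})⋯π₊(d₁)` (ordered product, in
decreasing order of indices, over the indices strictly below `k`). -/
def facePartial {G : Type*} [Group G] (πp : G → G) {n : ℕ}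
    (d : Fin n → G) (k : Fin n) : G :=
  ((((List.finRange n).filter (fun i => decide (i < k))).reverse).map
    (fun i => πp (d i))).prod

/-- The face action `(x ▷_f d)ₖ = dₖ·π₋(hₖ(d)·x⁻¹)` of `G₋` on `Gⁿ`,
for a face all of whose adjacent edges are oriented clockwise. -/
def faceAct {G : Type*} [Group G] (πm πp : G → G) {n : ℕ}
    (x : G) (d : Fin n → G) : Fin n → G :=
  fun k => d k * πm (facePartial πp d k * x⁻¹)

theorem List.filter_lt_finRange {n : ℕ} (k : Fin n) :
    (List.finRange n).filter (fun i => decide (i < k)) = (List.finRange n).take k := by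
  induction n with
  | zero => exact k.elim0
  | succ n ih =>
    rw [List.finRange_succ]
    cases k using Fin.cases with
    | zero => simp
    | succ j => simp [List.filter_map, Function.comp_def, ih, List.map_take]

section Factorization

variable {G : Type*} [Group G]

theorem facePartial_zero (πp : G → G) {n : ℕ} (d : Fin n → G) (h : 0 < n) :
    facePartial πp d ⟨0, h⟩ = 1 := by
  simp [facePartial, List.filter_lt_finRange]

theorem facePartial_succ (πp : G → G) {n : ℕ} (d : Fin n → G) (k : ℕ) (h : k + 1 < n) :
    facePartial πp d ⟨k + 1, h⟩ =
      πp (d ⟨k, Nat.lt_of_succ_lt h⟩) * facePartial πp d ⟨k, Nat.lt_of_succ_lt h⟩ := by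
  have hk : k < (List.finRange n).length := by simp; omega
  simp [facePartial, List.filter_lt_finRange, List.take_succ_eq_append_getElem hk]

theorem facePartial_mem {Gp : Subgroup G} {πp : G → G} (hπp : ∀ g, πp g ∈ Gp) {n : ℕ}
    (d : Fin n → G) (k : Fin n) : facePartial πp d k ∈ Gp := by
  refine Subgroup.list_prod_mem _ fun g hg => ?_
  obtain ⟨i, -, rfl⟩ := List.mem_map.1 hg
  exact hπp _

variable {Gm Gp : Subgroup G} (hc : Subgroup.IsComplement (Gm : Set G) (Gp : Set G))
  {πm πp : G → G} (hπm : ∀ g, πm g ∈ Gm) (hπp : ∀ g, πp g ∈ Gp)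
  (hfact : ∀ g, g = πm g * πp g)

include hc hπm hπp hfact

theorem proj_mul_eq {a b : G} (ha : a ∈ Gm) (hb : b ∈ Gp) :
    πm (a * b) = a ∧ πp (a * b) = b := by
  have h := @hc.1 (⟨πm (a * b), hπm _⟩, ⟨πp (a * b), hπp _⟩) (⟨a, ha⟩, ⟨b, hb⟩)
    (hfact (a * b)).symm
  simpa using h

theorem proj_mul_mul_eq {a b : G} (ha : a ∈ Gm) (hb : b ∈ Gp) (g : G) :
    πm (a * g * b) = a * πm g ∧ πp (a * g * b) = πp g * b := by
  have h := proj_mul_eq hc hπm hπp hfact (Gm.mul_mem ha (hπm g)) (Gp.mul_mem (hπp g) hb)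
  have e : a * πm g * (πp g * b) = a * g * b := by
    conv_rhs => rw [hfact g]
    group
  rwa [e] at h

theorem facePartial_faceAct {n : ℕ} (d : Fin n → G) {y : G} (hy : y ∈ Gm) (k : Fin n) :
    facePartial πp (faceAct πm πp y d) k = πp (facePartial πp d k * y⁻¹) := by
  obtain ⟨k, hk⟩ := k
  induction k with
  | zero =>
    have h := (proj_mul_eq hc hπm hπp hfact (Gm.inv_mem hy) Gp.one_mem).2
    simpa [facePartial_zero] using h.symm
  | succ k ih =>
    rw [facePartial_succ, facePartial_succ, ih]
    set c := d ⟨k, Nat.lt_of_succ_lt hk⟩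
    set a := facePartial πp d ⟨k, Nat.lt_of_succ_lt hk⟩ * y⁻¹ with ha
    have h₁ := (proj_mul_mul_eq hc hπm hπp hfact Gm.one_mem (hπp a) (c * πm a)).2
    have h₂ := (proj_mul_mul_eq hc hπm hπp hfact (hπm c) Gp.one_mem (πp c * a)).2
    rw [one_mul, mul_assoc, ← hfact a] at h₁
    rw [mul_one, mul_one, ← mul_assoc, ← hfact c] at h₂
    rw [mul_assoc, ← ha, ← h₂, h₁]
    rfl

end Factorization

/-- **The face action is a group action of `G₋` on `Gⁿ`:**
`1 ▷_f d = d` and `x ▷_f (y ▷_f d) = (x·y) ▷_f d` for all `x, y ∈ G₋`, `d ∈ Gⁿ`. -/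
theorem faceAct_is_group_action {G : Type*} [Group G] (Gm Gp : Subgroup G)
    (hc : Subgroup.IsComplement (Gm : Set G) (Gp : Set G))
    (πm πp : G → G)
    (hπm : ∀ g, πm g ∈ Gm) (hπp : ∀ g, πp g ∈ Gp)
    (hfact : ∀ g, g = πm g * πp g) :
    ∀ n : ℕ, 1 ≤ n → ∀ d : Fin n → G,
      faceAct πm πp (1 : G) d = d ∧
      ∀ x y : G, x ∈ Gm → y ∈ Gm →
        faceAct πm πp x (faceAct πm πp y d) = faceAct πm πp (x * y) d := by
  intro n _ d
  refine ⟨?_, fun x y hx hy => ?_⟩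
  · funext k
    have h := proj_mul_eq hc hπm hπp hfact Gm.one_mem (facePartial_mem hπp d k)
    simpa [faceAct] using h.1
  · funext k
    have h := (proj_mul_mul_eq hc hπm hπp hfact (hπm (facePartial πp d k * y⁻¹)) Gp.one_mem
      (πp (facePartial πp d k * y⁻¹) * x⁻¹)).1
    rw [mul_one, ← mul_assoc, ← hfact] at h
    change faceAct πm πp y d k * πm (facePartial πp (faceAct πm πp y d) k * x⁻¹) = _
    rw [facePartial_faceAct hc hπm hπp hfact d hy]
    simp only [faceAct, mul_inv_rev]
    rw [← mul_assoc (facePartial πp d k), h, mul_assoc]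
end

section
/- The face holonomy intertwines the face action with the dressing action of G₋ on G₊: for all n ≥ 1, x ∈ G₋ and d ∈ Gⁿ one has Hol_f(x ▷_f d) = π₊(Hol_f(d)·x⁻¹), i.e. π₊(dₙ·π₋(hₙ(d)·x⁻¹))⋯π₊(d₁·π₋(h₁(d)·x⁻¹)) = π₊(π₊(dₙ)⋯π₊(d₁)·x⁻¹). (The intertwining part of the Proposition 'Holonomies and dressing transformations', for a face with all edges oriented clockwise.) -/
/-- The face holonomy `Hol_f(d) = π₊(dₙ)⋯π₊(d₁)`. -/
def faceHol {G : Type*} [Group G] (πp : G → G) {n : ℕ} (d : Fin n → G) : G :=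
  (((List.finRange n).reverse).map (fun i => πp (d i))).prod

theorem proj_mul_of_isComplement {G : Type*} [Group G] {Gm Gp : Subgroup G}
    (hc : Subgroup.IsComplement (Gm : Set G) (Gp : Set G)) {πm πp : G → G}
    (hπm : ∀ g, πm g ∈ Gm) (hπp : ∀ g, πp g ∈ Gp) (hfact : ∀ g, g = πm g * πp g)
    {m p : G} (hm : m ∈ Gm) (hp : p ∈ Gp) : πp (m * p) = p := by
  have h := @hc.1 (⟨πm (m * p), hπm _⟩, ⟨πp (m * p), hπp _⟩) (⟨m, hm⟩, ⟨p, hp⟩)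
    (hfact (m * p)).symm
  exact congrArg (fun y => (y.2 : G)) h

/-- The compatibility `π₊(a·π₋(g))·π₊(g) = π₊(π₊(a)·g)` of the two projections. -/
theorem proj_mul_proj {G : Type*} [Group G] {Gm Gp : Subgroup G}
    (hc : Subgroup.IsComplement (Gm : Set G) (Gp : Set G)) {πm πp : G → G}
    (hπm : ∀ g, πm g ∈ Gm) (hπp : ∀ g, πp g ∈ Gp) (hfact : ∀ g, g = πm g * πp g)
    (a g : G) : πp (a * πm g) * πp g = πp (πp a * g) := by
  have key : πp a * g = ((πm a)⁻¹ * πm (a * πm g)) * (πp (a * πm g) * πp g) := by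
    calc πp a * g = (πm a)⁻¹ * (πm a * πp a) * g := by group
      _ = (πm a)⁻¹ * (a * πm g) * πp g := by
        rw [← hfact a, mul_assoc, mul_assoc, mul_assoc, ← hfact g]
      _ = (πm a)⁻¹ * (πm (a * πm g) * πp (a * πm g)) * πp g := by rw [← hfact (a * πm g)]
      _ = _ := by group
  rw [key]
  exact (proj_mul_of_isComplement hc hπm hπp hfact
    (Gm.mul_mem (Gm.inv_mem (hπm a)) (hπm _)) (Gp.mul_mem (hπp _) (hπp g))).symm

theorem faceHol_succ {G : Type*} [Group G] (πp : G → G) {n : ℕ} (d : Fin (n + 1) → G) :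
    faceHol πp d = πp (d (Fin.last n)) * faceHol πp (fun i => d i.castSucc) := by
  simp [faceHol, List.finRange_succ_last, Function.comp_def]

theorem facePartial_last {G : Type*} [Group G] (πp : G → G) {n : ℕ} (d : Fin (n + 1) → G) :
    facePartial πp d (Fin.last n) = faceHol πp (fun i => d i.castSucc) := by
  simp [facePartial, faceHol, List.finRange_succ_last, List.filter_map, Function.comp_def,
    Fin.castSucc_lt_last]

theorem facePartial_castSucc {G : Type*} [Group G] (πp : G → G) {n : ℕ} (d : Fin (n + 1) → G)
    (k : Fin n) : facePartial πp d k.castSucc = facePartial πp (fun i => d i.castSucc) k := by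
  simp [facePartial, List.finRange_succ_last, List.filter_map, Function.comp_def,
    (Fin.castSucc_lt_last k).le]

theorem faceAct_castSucc {G : Type*} [Group G] (πm πp : G → G) {n : ℕ} (x : G)
    (d : Fin (n + 1) → G) :
    (fun i : Fin n => faceAct πm πp x d i.castSucc) =
      faceAct πm πp x (fun i => d i.castSucc) := by
  funext i
  simp only [faceAct, facePartial_castSucc]

/-- **The face holonomy intertwines the face action with the dressing action of
`G₋` on `G₊`:** for all `n ≥ 1`, `x ∈ G₋`, `d ∈ Gⁿ` one has
`Hol_f(x ▷_f d) = π₊(Hol_f(d)·x⁻¹)`. -/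
theorem faceHol_intertwines {G : Type*} [Group G] (Gm Gp : Subgroup G)
    (hc : Subgroup.IsComplement (Gm : Set G) (Gp : Set G))
    (πm πp : G → G)
    (hπm : ∀ g, πm g ∈ Gm) (hπp : ∀ g, πp g ∈ Gp)
    (hfact : ∀ g, g = πm g * πp g) :
    ∀ n : ℕ, 1 ≤ n → ∀ x : G, x ∈ Gm → ∀ d : Fin n → G,
      faceHol πp (faceAct πm πp x d) = πp (faceHol πp d * x⁻¹) := by
  intro n hn x hx d
  clear hn
  induction n with
  | zero =>
    simpa [faceHol] using
      (proj_mul_of_isComplement hc hπm hπp hfact (Gm.inv_mem hx) Gp.one_mem).symm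
  | succ n ih =>
    rw [faceHol_succ, faceHol_succ, faceAct_castSucc, ih, faceAct, facePartial_last, mul_assoc]
    exact proj_mul_proj hc hπm hπp hfact _ _
end

section
/- On elements flat at the two-edge face, splitting after gluing equals a gauge transformation: if d₁, d₂ ∈ G satisfy π₊(d₂⁻¹)·π₊(d₁) = 1, then with x := π₋(π₊(d₁)⁻¹·d₂)⁻¹ ∈ G₋ one has d₁·x⁻¹ = π₋(d₁)·d₂ and π₋(π₊(d₁)·x⁻¹)⁻¹·d₂ = π₊(π₋(d₁)·d₂); that is, (φ ∘ ψ)(d₁, d₂) = x ▷ (d₁, d₂). (The face case of the identity used in the proof of Proposition 3.12 (iii).) -/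
/-- The components of a factorization along complementary subgroups are determined by the
product. -/
theorem Subgroup.IsComplement.components_mul_eq {G : Type*} [Group G] {Gm Gp : Subgroup G}
    (hc : Subgroup.IsComplement (Gm : Set G) (Gp : Set G)) {πm πp : G → G}
    (hπm : ∀ g, πm g ∈ Gm) (hπp : ∀ g, πp g ∈ Gp) (hfact : ∀ g, g = πm g * πp g)
    {m p : G} (hm : m ∈ Gm) (hp : p ∈ Gp) : πm (m * p) = m ∧ πp (m * p) = p := by
  have h := @hc.1 (⟨πm (m * p), hπm _⟩, ⟨πp (m * p), hπp _⟩) (⟨m, hm⟩, ⟨p, hp⟩)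
    (hfact (m * p)).symm
  simpa using h

/-- **Splitting after gluing at a flat two-edge face is a gauge
transformation:** if `d₁, d₂ ∈ G` satisfy `π₊(d₂⁻¹)·π₊(d₁) = 1`, then with
`x := π₋(π₊(d₁)⁻¹·d₂)⁻¹ ∈ G₋` one has `d₁·x⁻¹ = π₋(d₁)·d₂` and
`π₋(π₊(d₁)·x⁻¹)⁻¹·d₂ = π₊(π₋(d₁)·d₂)`; that is, `(φ ∘ ψ)(d₁, d₂) = x ▷ (d₁, d₂)`
for the gluing map `ψ(d₁, d₂) = π₋(d₁)·d₂`, the splitting map `φ(g) = (g, π₊(g))`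
and the face action `x ▷ (d₁, d₂) = (d₁·x⁻¹, π₋(π₊(d₁)·x⁻¹)⁻¹·d₂)`. -/
theorem split_after_glue_face {G : Type*} [Group G] (Gm Gp : Subgroup G)
    (hc : Subgroup.IsComplement (Gm : Set G) (Gp : Set G))
    (πm πp : G → G)
    (hπm : ∀ g, πm g ∈ Gm) (hπp : ∀ g, πp g ∈ Gp)
    (hfact : ∀ g, g = πm g * πp g) :
    ∀ d₁ d₂ : G, πp d₂⁻¹ * πp d₁ = 1 →
      let x := (πm ((πp d₁)⁻¹ * d₂))⁻¹
      x ∈ Gm ∧ d₁ * x⁻¹ = πm d₁ * d₂ ∧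
        (πm (πp d₁ * x⁻¹))⁻¹ * d₂ = πp (πm d₁ * d₂) := by
  intro d₁ d₂ h x
  have hd₂ : (πp d₁)⁻¹ * d₂ = (πm d₂⁻¹)⁻¹ := by
    rw [← eq_inv_of_mul_eq_one_left h, ← mul_inv_eq_iff_eq_mul.mpr (hfact d₂⁻¹)]
    group
  have hx : x⁻¹ = (πp d₁)⁻¹ * d₂ := by
    have h₁ := (hc.components_mul_eq hπm hπp hfact (Gm.inv_mem (hπm d₂⁻¹)) Gp.one_mem).1
    rw [mul_one, ← hd₂] at h₁
    simpa [x] using h₁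
  refine ⟨Gm.inv_mem (hπm _), ?_, ?_⟩
  · rw [hx, ← mul_assoc, ← eq_mul_inv_of_mul_eq (hfact d₁).symm]
  · have h₂ := (hc.components_mul_eq hπm hπp hfact
      (Gm.mul_mem (hπm d₁) (hπm d₂)) (hπp d₂)).2
    rw [mul_assoc, ← hfact d₂] at h₂
    rw [h₂, hx, mul_inv_cancel_left]
    exact inv_mul_eq_of_eq_mul (hfact d₂)
end
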